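/- Let S ⊆ ℕ^d be a good semigroup and let ω = (w₁,…,w_d) ∈ S be a nonzero element with w₁ ≥ w₂ ≥ ⋯ ≥ w_d. For k = 1,…,d set s_k = w₁ + ⋯ + w_k. Let E = ω + S, A = S \ E = Ap(S,ω), and let A = A₁ ∪ ⋯ ∪ A_N be the partition of A into levels. Then for every k ∈ {1,…,d} and every i ∈ {1,…,N}, the level A_i contains a subspace of dimension d − k (i.e. a U-subspace for some U ⊆ I with |U| = k) if and only if i ≥ N − s_k + 1. In particular, N = s_d = w₁ + w₂ + ⋯ + w_d. -/

import Mathlib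

/-! Common definitions for good semigroups in `ℕ^d`. -/

/-- A *good semigroup*: a submonoid of `ℕ^d` satisfying (G1), (G2), (G3). -/
def IsGoodSemigroup {d : ℕ} (S : Set (Fin d → ℕ)) : Prop :=
  (0 : Fin d → ℕ) ∈ S ∧
  (∀ α ∈ S, ∀ β ∈ S, α + β ∈ S) ∧
  (∀ α ∈ S, ∀ β ∈ S, α ⊓ β ∈ S) ∧
  (∀ α ∈ S, ∀ β ∈ S, α ≠ β → ∀ i : Fin d, α i = β i →
    ∃ ε ∈ S, α i < ε i ∧ ∀ j : Fin d, j ≠ i →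
      min (α j) (β j) ≤ ε j ∧ (α j ≠ β j → ε j = min (α j) (β j))) ∧
  (∃ c : Fin d → ℕ, ∀ x : Fin d → ℕ, c ≤ x → x ∈ S)

/-- A *good ideal* of `S`: a nonempty subset `E ⊆ S` with `E + S ⊆ E`
satisfying (G1) and (G2). -/
def IsGoodIdeal {d : ℕ} (S E : Set (Fin d → ℕ)) : Prop :=
  E ⊆ S ∧ E.Nonempty ∧
  (∀ α ∈ E, ∀ σ ∈ S, α + σ ∈ E) ∧
  (∀ α ∈ E, ∀ β ∈ E, α ⊓ β ∈ E) ∧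
  (∀ α ∈ E, ∀ β ∈ E, α ≠ β → ∀ i : Fin d, α i = β i →
    ∃ ε ∈ E, α i < ε i ∧ ∀ j : Fin d, j ≠ i →
      min (α j) (β j) ≤ ε j ∧ (α j ≠ β j → ε j = min (α j) (β j)))

/-- `Δ^E_F(α)`. -/
def DeltaSet {d : ℕ} (E : Set (Fin d → ℕ)) (F : Finset (Fin d)) (α : Fin d → ℕ) :
    Set (Fin d → ℕ) :=
  {β | β ∈ E ∧ (∀ i ∈ F, β i = α i) ∧ ∀ j ∉ F, α j < β j}

/-- `Δ̃^E_F(α)`. -/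
def DeltaTilde {d : ℕ} (E : Set (Fin d → ℕ)) (F : Finset (Fin d)) (α : Fin d → ℕ) :
    Set (Fin d → ℕ) :=
  {β | β ∈ E ∧ (∀ i ∈ F, β i = α i) ∧ ∀ j ∉ F, α j ≤ β j} \ {α}

/-- `c` is the conductor of `E`: the minimal element with `c + ℕ^d ⊆ E`. -/
def IsConductor {d : ℕ} (E : Set (Fin d → ℕ)) (c : Fin d → ℕ) : Prop :=
  (∀ x : Fin d → ℕ, c ≤ x → x ∈ E) ∧
  ∀ c' : Fin d → ℕ, (∀ x : Fin d → ℕ, c' ≤ x → x ∈ E) → c ≤ c'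

/-- `α ≤ β` are consecutive in `A`. -/
def ConsecutiveIn {d : ℕ} (A : Set (Fin d → ℕ)) (α β : Fin d → ℕ) : Prop :=
  α ∈ A ∧ β ∈ A ∧ α ≤ β ∧
  ∀ δ ∈ A, α ≤ δ → δ ≤ β → δ = α ∨ δ = β

/-- `α` is the complete infimum of the family `β` (with `Δ`-sets taken in `S`). -/
def IsCompleteInf {d : ℕ} (S : Set (Fin d → ℕ)) (α : Fin d → ℕ) {r : ℕ}
    (β : Fin r → Fin d → ℕ) : Prop :=
  2 ≤ r ∧ ∃ F : Fin r → Finset (Fin d),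
    (∀ j, (F j).Nonempty ∧ F j ≠ Finset.univ) ∧
    (∀ j, β j ∈ DeltaSet S (F j) α) ∧
    (∀ j k, j ≠ k → α = β j ⊓ β k) ∧
    (∀ x : Fin d, ∃ j, x ∉ F j)

/-- `α` is a complete infimum in `A` of the elements of the family `β`. -/
def IsCompleteInfIn {d : ℕ} (S A : Set (Fin d → ℕ)) (α : Fin d → ℕ) {r : ℕ}
    (β : Fin r → Fin d → ℕ) : Prop :=
  α ∈ A ∧ (∀ k, β k ∈ A) ∧ IsCompleteInf S α β

/-- The order `≤≤`: `α = β` or `α_j < β_j` for every `j`. -/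
def DomLE {d : ℕ} (α β : Fin d → ℕ) : Prop := α = β ∨ ∀ j, α j < β j

/-- The set `B`: maximal elements of `(S \ E) \ prev` with respect to `≤≤`. -/
def Bstep {d : ℕ} (S E prev : Set (Fin d → ℕ)) : Set (Fin d → ℕ) :=
  {α | α ∈ (S \ E) \ prev ∧ ∀ β ∈ (S \ E) \ prev, DomLE α β → β = α}

/-- The set `C`: elements of `B` that are complete infima in `S \ E` of
elements of `B` (with `1 < r ≤ d`). -/
def Cstep {d : ℕ} (S E prev : Set (Fin d → ℕ)) : Set (Fin d → ℕ) :=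
  {α | α ∈ Bstep S E prev ∧ ∃ r : ℕ, 1 < r ∧ r ≤ d ∧
    ∃ β : Fin r → Fin d → ℕ, (∀ k, β k ∈ Bstep S E prev) ∧
      IsCompleteInfIn S (S \ E) α β}

/-- `D = B \ C`. -/
def Dstep {d : ℕ} (S E prev : Set (Fin d → ℕ)) : Set (Fin d → ℕ) :=
  Bstep S E prev \ Cstep S E prev

/-- `Dacc S E i = D^(1) ∪ ⋯ ∪ D^(i)`. -/
def Dacc {d : ℕ} (S E : Set (Fin d → ℕ)) : ℕ → Set (Fin d → ℕ)
  | 0 => ∅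
  | (i + 1) => Dacc S E i ∪ Dstep S E (Dacc S E i)

/-- `N` is the number of levels of `S \ E`: the least `N` with
`S \ E = D^(1) ∪ ⋯ ∪ D^(N)`. -/
def IsLevelsNumber {d : ℕ} (S E : Set (Fin d → ℕ)) (N : ℕ) : Prop :=
  (S \ E) ⊆ Dacc S E N ∧ ∀ M : ℕ, (S \ E) ⊆ Dacc S E M → N ≤ M

/-- The level `A_i := D^(N+1-i)` for `1 ≤ i ≤ N` (and `∅` otherwise). -/
def Alevel {d : ℕ} (S E : Set (Fin d → ℕ)) (N i : ℕ) : Set (Fin d → ℕ) :=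
  if 1 ≤ i ∧ i ≤ N then Dstep S E (Dacc S E (N - i)) else ∅

/-- `α` is (the representative of) a `U`-subspace of `E` (w.r.t. conductor `cE`):
`α ∈ E` and `α_j = cE_j` for every `j ∉ U`. -/
def IsSubspaceRep {d : ℕ} (E : Set (Fin d → ℕ)) (cE : Fin d → ℕ)
    (U : Finset (Fin d)) (α : Fin d → ℕ) : Prop :=
  α ∈ E ∧ ∀ j ∉ U, α j = cE j

/-- `β(U) ∈ Δ^E_F(α(U))`, at the level of representatives. -/
def SubDelta {d : ℕ} (E : Set (Fin d → ℕ)) (cE : Fin d → ℕ)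
    (U F : Finset (Fin d)) (α β : Fin d → ℕ) : Prop :=
  IsSubspaceRep E cE U β ∧ (∀ j ∈ F, β j = α j) ∧
  ∀ j ∈ U, j ∉ F → α j < β j

/-- `β(U) ∈ Δ̃^E_F(α(U))`, at the level of representatives. -/
def SubDeltaT {d : ℕ} (E : Set (Fin d → ℕ)) (cE : Fin d → ℕ)
    (U F : Finset (Fin d)) (α β : Fin d → ℕ) : Prop :=
  IsSubspaceRep E cE U β ∧ (∀ j ∈ F, β j = α j) ∧
  (∀ j ∈ U, j ∉ F → α j ≤ β j) ∧ ¬(∀ j ∈ U, β j = α j)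

/-- `α(U) ≤ θ(U)` are consecutive among the `U`-subspaces of `S`. -/
def SubConsecutive {d : ℕ} (S : Set (Fin d → ℕ)) (cE : Fin d → ℕ)
    (U : Finset (Fin d)) (α β : Fin d → ℕ) : Prop :=
  IsSubspaceRep S cE U α ∧ IsSubspaceRep S cE U β ∧ (∀ i ∈ U, α i ≤ β i) ∧
  ∀ δ : Fin d → ℕ, IsSubspaceRep S cE U δ → (∀ i ∈ U, α i ≤ δ i) →
    (∀ i ∈ U, δ i ≤ β i) → (∀ i ∈ U, δ i = α i) ∨ (∀ i ∈ U, δ i = β i)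

/-- `α(U)` is the complete infimum of the family of `U`-subspaces `β`. -/
def SubIsCompleteInf {d : ℕ} (S : Set (Fin d → ℕ)) (cE : Fin d → ℕ)
    (U : Finset (Fin d)) (α : Fin d → ℕ) {r : ℕ}
    (β : Fin r → Fin d → ℕ) : Prop :=
  2 ≤ r ∧ ∃ F : Fin r → Finset (Fin d),
    (∀ j, (F j).Nonempty ∧ F j ⊂ U) ∧
    (∀ j, SubDelta S cE U (F j) α (β j)) ∧
    (∀ j k, j ≠ k → ∀ i ∈ U, α i = min (β j i) (β k i)) ∧
    (∀ x : Fin d, ∃ j, x ∉ F j)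


/-! Helper material. -/

section Helpers

open Classical

variable {d : ℕ}

/-- The unit vector. -/
def ev (i : Fin d) : Fin d → ℕ := Pi.single i 1

lemma ev_self (i : Fin d) : ev i i = 1 := by simp [ev]

lemma ev_ne {i j : Fin d} (h : j ≠ i) : ev i j = 0 := by simp [ev, h]

lemma sum_ev (i : Fin d) : Finset.univ.sum (ev i) = 1 := by simp [ev]

lemma exists_pred {γ : Fin d → ℕ} {i : Fin d} (h : 0 < γ i) : ∃ δ, γ = δ + ev i := by
  refine ⟨γ - ev i, ?_⟩
  funext j
  by_cases hj : j = i
  · subst hj; simp [ev_self]; omega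
  · simp [ev_ne hj]

lemma vec_ind {P : (Fin d → ℕ) → Prop} (h0 : P 0) (hs : ∀ η i, P η → P (η + ev i)) :
    ∀ η, P η := by
  have key : ∀ n : ℕ, ∀ η : Fin d → ℕ, Finset.univ.sum η = n → P η := by
    intro n
    induction n with
    | zero =>
      intro η hη
      have : η = 0 := by
        funext j
        have := (Finset.sum_eq_zero_iff.mp hη) j (Finset.mem_univ j)
        simpa using this
      rw [this]; exact h0
    | succ n ih =>
      intro η hη
      have : ∃ i, 0 < η i := by
        by_contra hcon
        push Not at hcon
        have : Finset.univ.sum η = 0 := Finset.sum_eq_zero (fun i _ => by have := hcon i; omega)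
        omega
      obtain ⟨i, hi⟩ := this
      obtain ⟨δ, rfl⟩ := exists_pred hi
      apply hs
      apply ih
      have e : Finset.univ.sum (δ + ev i) = Finset.univ.sum δ + Finset.univ.sum (ev i) := by
        simp [Finset.sum_add_distrib]
      rw [sum_ev] at e
      omega
  intro η
  exact key _ η rfl

/-- Recursive construction of a potential for a closed 1-form. -/
noncomputable def phiAux (w : (Fin d → ℕ) → Fin d → ℕ) : ℕ → (Fin d → ℕ) → ℕ
  | 0, _ => 0
  | (n + 1), γ => if h : ∃ i, 0 < γ i then
      phiAux w n (γ - ev h.choose) + w (γ - ev h.choose) h.choose else 0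

lemma phiAux_step (w : (Fin d → ℕ) → Fin d → ℕ)
    (hw : ∀ γ i j, i ≠ j → w γ i + w (γ + ev i) j = w γ j + w (γ + ev j) i) :
    ∀ n γ, Finset.univ.sum γ = n → ∀ i, phiAux w (n + 1) (γ + ev i) = phiAux w n γ + w γ i := by
  intro n
  induction n with
  | zero =>
    intro γ hγ i
    have hz : γ = 0 := by
      funext j
      have := (Finset.sum_eq_zero_iff.mp hγ) j (Finset.mem_univ j)
      simpa using this
    subst hz
    have h : ∃ j, 0 < ((0 : Fin d → ℕ) + ev i) j := ⟨i, by simp [ev_self]⟩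
    have hk : h.choose = i := by
      by_contra hne
      have := h.choose_spec
      rw [Pi.add_apply, ev_ne hne] at this
      simp at this
    show (if h : ∃ j, 0 < ((0 : Fin d → ℕ) + ev i) j then _ else 0) = 0 + w 0 i
    rw [dif_pos h, hk]
    simp [phiAux]
  | succ n ih =>
    intro γ hγ i
    have h : ∃ j, 0 < (γ + ev i) j := ⟨i, by simp [ev_self]⟩
    rw [phiAux, dif_pos h]
    have hk0 := h.choose_spec
    generalize h.choose = k at hk0
    by_cases hk : k = i
    · subst hk
      simp
    · rw [Pi.add_apply, ev_ne hk, add_zero] at hk0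
      obtain ⟨δ, rfl⟩ := exists_pred hk0
      have e1 : δ + ev k + ev i - ev k = δ + ev i := by
        rw [add_right_comm]; simp
      have hs : Finset.univ.sum δ = n := by
        have e : Finset.univ.sum (δ + ev k) = Finset.univ.sum δ + Finset.univ.sum (ev k) := by
          simp [Finset.sum_add_distrib]
        rw [sum_ev] at e
        omega
      rw [e1, ih δ hs i, ih δ hs k]
      have := hw δ i k (Ne.symm hk)
      omega

lemma exists_potential (w : (Fin d → ℕ) → Fin d → ℕ)
    (hw : ∀ γ i j, i ≠ j → w γ i + w (γ + ev i) j = w γ j + w (γ + ev j) i) :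
    ∃ φ : (Fin d → ℕ) → ℕ, ∀ γ i, φ (γ + ev i) = φ γ + w γ i := by
  refine ⟨fun γ => phiAux w (Finset.univ.sum γ) γ, ?_⟩
  intro γ i
  have e : Finset.univ.sum (γ + ev i) = Finset.univ.sum γ + 1 := by
    rw [← sum_ev i]; simp [Finset.sum_add_distrib]
  show phiAux w (Finset.univ.sum (γ + ev i)) (γ + ev i) = _
  rw [e]
  exact phiAux_step w hw _ γ rfl i

/-- Some element of `X` above `γ` has the same `i`-th coordinate. -/
def Chi (X : Set (Fin d → ℕ)) (γ : Fin d → ℕ) (i : Fin d) : Prop :=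
  ∃ β ∈ X, γ ≤ β ∧ β i = γ i

/-- Property (G2). -/
def GTwo (X : Set (Fin d → ℕ)) : Prop :=
  ∀ α ∈ X, ∀ β ∈ X, α ≠ β → ∀ i : Fin d, α i = β i →
    ∃ ε ∈ X, α i < ε i ∧ ∀ j : Fin d, j ≠ i →
      min (α j) (β j) ≤ ε j ∧ (α j ≠ β j → ε j = min (α j) (β j))

lemma ple {γ β : Fin d → ℕ} (h : γ ≤ β) (i : Fin d) : γ i ≤ β i := h i

lemma le_add_ev (γ : Fin d → ℕ) (i : Fin d) : γ ≤ γ + ev i := by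
  intro j; simp

lemma add_ev_le {γ β : Fin d → ℕ} {i : Fin d} (h : γ ≤ β) (hi : γ i < β i) : γ + ev i ≤ β := by
  intro j
  by_cases hj : j = i
  · subst hj; simp [ev_self]; omega
  · simp [ev_ne hj]; exact h j

lemma lt_of_add_ev_le {γ β : Fin d → ℕ} {i : Fin d} (h : γ + ev i ≤ β) : γ i < β i := by
  have := h i
  simp [ev_self] at this
  omega

lemma chi_mono {X : Set (Fin d → ℕ)} {γ : Fin d → ℕ} {i j : Fin d} (hij : i ≠ j)
    (h : Chi X (γ + ev i) j) : Chi X γ j := by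
  obtain ⟨β, hβ, hle, he⟩ := h
  refine ⟨β, hβ, (le_add_ev γ i).trans hle, ?_⟩
  rw [he, Pi.add_apply, ev_ne (Ne.symm hij), add_zero]

lemma chi_of_not {X : Set (Fin d → ℕ)} {γ : Fin d → ℕ} {i j : Fin d} (hij : i ≠ j)
    (h : Chi X γ j) (hn : ¬ Chi X γ i) : Chi X (γ + ev i) j := by
  obtain ⟨β, hβ, hle, he⟩ := h
  refine ⟨β, hβ, add_ev_le hle ?_, ?_⟩
  · have := ple hle i
    rcases Nat.lt_or_ge (γ i) (β i) with h1 | h1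
    · exact h1
    · exact absurd ⟨β, hβ, hle, by omega⟩ hn
  · rw [he, Pi.add_apply, ev_ne (Ne.symm hij), add_zero]

lemma chi_swap {X : Set (Fin d → ℕ)} (hX : GTwo X) {γ : Fin d → ℕ} {i j : Fin d} (hij : i ≠ j)
    (hi : Chi X γ i) (h : Chi X (γ + ev i) j) : Chi X (γ + ev j) i := by
  obtain ⟨β, hβ, hle, he⟩ := h
  obtain ⟨β', hβ', hle', he'⟩ := hi
  have h1 : γ i < β i := lt_of_add_ev_le hle
  have h2 : γ ≤ β := (le_add_ev γ i).trans hle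
  have h3 : β j = γ j := by rw [he, Pi.add_apply, ev_ne (Ne.symm hij), add_zero]
  have e : (γ + ev j) i = γ i := by rw [Pi.add_apply, ev_ne hij, add_zero]
  by_cases hj : γ j < β' j
  · exact ⟨β', hβ', add_ev_le hle' hj, by rw [e, he']⟩
  · have hj' : β' j = γ j := le_antisymm (not_lt.mp hj) (hle' j)
    have hne : β ≠ β' := by
      intro hh; rw [hh] at h1; omega
    obtain ⟨ε, hε, h4, h5⟩ := hX β hβ β' hβ' hne j (by omega)
    have hge : γ ≤ ε := by
      intro k
      by_cases hk : k = j
      · rw [hk]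
        show γ j ≤ ε j
        omega
      · have := (h5 k hk).1
        have a1 := ple h2 k
        have a2 := ple hle' k
        show γ k ≤ ε k
        omega
    refine ⟨ε, hε, add_ev_le hge (by omega), ?_⟩
    have := (h5 i hij).2 (by omega)
    omega

lemma exists_phi {X : Set (Fin d → ℕ)} (hX : GTwo X) :
    ∃ φ : (Fin d → ℕ) → ℕ, ∀ γ i, φ (γ + ev i) = φ γ + if Chi X γ i then 1 else 0 := by
  apply exists_potential (fun γ i => if Chi X γ i then 1 else 0)
  intro γ i j hij
  have a1 := @chi_mono d X γ i j hij
  have a2 := @chi_mono d X γ j i (Ne.symm hij)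
  have a3 := @chi_of_not d X γ i j hij
  have a4 := @chi_of_not d X γ j i (Ne.symm hij)
  have a5 := @chi_swap d X hX γ i j hij
  have a6 := @chi_swap d X hX γ j i (Ne.symm hij)
  by_cases c1 : Chi X γ i <;> by_cases c2 : Chi X γ j <;>
    by_cases c3 : Chi X (γ + ev i) j <;> by_cases c4 : Chi X (γ + ev j) i <;>
    simp_all

lemma phi_count {X : Set (Fin d → ℕ)} {c : Fin d → ℕ} (hc : ∀ x, c ≤ x → x ∈ X)
    {φ : (Fin d → ℕ) → ℕ} (hφ : ∀ γ i, φ (γ + ev i) = φ γ + if Chi X γ i then 1 else 0)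
    (γ : Fin d → ℕ) : ∀ η : Fin d → ℕ, (∀ i, 0 < η i → c i ≤ γ i) →
      φ (γ + η) = φ γ + Finset.univ.sum η := by
  apply vec_ind
  · intro _; simp
  · intro η i ih h
    have h' : ∀ k, 0 < η k → c k ≤ γ k := fun k hk => h k (by simp; omega)
    have hi : c i ≤ γ i := h i (by simp [ev_self])
    have hchi : Chi X (γ + η) i := by
      refine ⟨(γ + η) ⊔ c, hc _ le_sup_right, le_sup_left, ?_⟩
      simp; omega
    rw [← add_assoc, hφ, ih h', if_pos hchi]
    have e : Finset.univ.sum (η + ev i) = Finset.univ.sum η + 1 := by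
      rw [← sum_ev i]; simp [Finset.sum_add_distrib]
    omega

/-- The `i`-th step at `γ` is a step of `S` and not of `E`. -/
def Drop (S E : Set (Fin d → ℕ)) (γ : Fin d → ℕ) (i : Fin d) : Prop :=
  Chi S γ i ∧ ¬ Chi E γ i

lemma exists_f {S E : Set (Fin d → ℕ)} {ω cE : Fin d → ℕ}
    (hS : GTwo S) (hES : E ⊆ S)
    (hEdef : E = {x | ∃ σ ∈ S, x = ω + σ})
    (hcE : ∀ x, cE ≤ x → x ∈ E) :
    ∃ f : (Fin d → ℕ) → ℕ,
      (∀ γ i, f γ = f (γ + ev i) + if Drop S E γ i then 1 else 0) ∧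
      (∀ γ, cE ≤ γ → f γ = 0) ∧
      (∀ U : Finset (Fin d), f (fun j => if j ∈ U then 0 else cE j) = U.sum ω) := by
  have hE : GTwo E := by
    rw [hEdef]
    rintro _ ⟨α, hα, rfl⟩ _ ⟨β, hβ, rfl⟩ hne i hi
    have hi' : α i = β i := by simpa using hi
    obtain ⟨ε, hε, h1, h2⟩ := hS α hα β hβ (fun h => hne (by rw [h])) i hi'
    refine ⟨ω + ε, ⟨ε, hε, rfl⟩, by simpa using h1, ?_⟩
    intro j hj
    obtain ⟨h3, h4⟩ := h2 j hj
    simp only [Pi.add_apply]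
    refine ⟨by omega, fun h5 => ?_⟩
    have := h4 (by omega)
    omega
  obtain ⟨φS, hφS⟩ := exists_phi hS
  obtain ⟨φE, hφE⟩ := exists_phi hE
  have hsub : ∀ γ i, Chi E γ i → Chi S γ i := by
    rintro γ i ⟨β, hβ, h⟩
    exact ⟨β, hES hβ, h⟩
  set ψ : (Fin d → ℕ) → ℤ := fun γ => (φS γ : ℤ) - φE γ with hψ
  have hstep : ∀ γ i, ψ (γ + ev i) = ψ γ + if Drop S E γ i then 1 else 0 := by
    intro γ i
    simp only [hψ, hφS, hφE, Drop]
    have := hsub γ i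
    by_cases c1 : Chi S γ i <;> by_cases c2 : Chi E γ i <;> simp_all <;> ring
  have hmono : ∀ γ η, ψ γ ≤ ψ (γ + η) := by
    intro γ
    apply vec_ind
    · simp
    · intro η i ih
      rw [← add_assoc, hstep]
      split_ifs <;> omega
  have htop : ∀ η, ψ (cE + η) = ψ cE := by
    apply vec_ind
    · simp
    · intro η i ih
      rw [← add_assoc, hstep, if_neg, ih, add_zero]
      rintro ⟨_, h⟩
      exact h ⟨cE + η, hcE _ (by intro j; simp), le_rfl, rfl⟩
  have htop' : ∀ γ, cE ≤ γ → ψ γ = ψ cE := by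
    intro γ hγ
    obtain ⟨η, rfl⟩ := exists_add_of_le hγ
    exact htop η
  have hle : ∀ γ, ψ γ ≤ ψ cE := by
    intro γ
    obtain ⟨η, hη⟩ := exists_add_of_le (le_sup_left : γ ≤ γ ⊔ cE)
    rw [← htop' (γ ⊔ cE) le_sup_right, hη]
    exact hmono γ η
  refine ⟨fun γ => (ψ cE - ψ γ).toNat, ?_, ?_, ?_⟩
  · intro γ i
    have h1 := hle γ
    have h2 := hle (γ + ev i)
    have h3 := hstep γ i
    show (ψ cE - ψ γ).toNat = (ψ cE - ψ (γ + ev i)).toNat + _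
    split_ifs at h3 ⊢ <;> omega
  · intro γ hγ
    show (ψ cE - ψ γ).toNat = 0
    rw [htop' γ hγ]; simp
  · intro U
    obtain ⟨c', hc'S, hc'⟩ : ∃ c' ∈ S, cE = ω + c' := by
      have := hcE cE le_rfl
      rw [hEdef] at this
      exact this
    have hc'up : ∀ x, c' ≤ x → x ∈ S := by
      intro x hx
      have h1 : ω + x ∈ E := hcE _ (by rw [hc']; exact add_le_add le_rfl hx)
      rw [hEdef] at h1
      obtain ⟨σ, hσ, h2⟩ := h1
      rw [add_left_cancel h2]; exact hσ
    have hshift : ∀ γ, φE (ω + γ) + φS 0 = φE ω + φS γ := by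
      apply vec_ind
      · simp
      · intro γ i ih
        have : Chi E (ω + γ) i ↔ Chi S γ i := by
          constructor
          · rintro ⟨β, hβ, h1, h2⟩
            rw [hEdef] at hβ
            obtain ⟨σ, hσ, rfl⟩ := hβ
            refine ⟨σ, hσ, fun j => ?_, ?_⟩
            · have := h1 j; simpa using this
            · simpa using h2
          · rintro ⟨β, hβ, h1, h2⟩
            refine ⟨ω + β, ?_, add_le_add le_rfl h1, ?_⟩
            · rw [hEdef]; exact ⟨β, hβ, rfl⟩
            · simp [h2]
        rw [← add_assoc, hφE, hφS]
        simp only [this]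
        omega
    have hlow : ∀ γ η, (∀ i, 0 < η i → γ i + η i ≤ ω i) → φE (γ + η) = φE γ := by
      intro γ
      apply vec_ind
      · simp
      · intro η i ih h
        have hi := h i (by simp [ev_self])
        simp [ev_self] at hi
        have h' : ∀ k, 0 < η k → γ k + η k ≤ ω k := by
          intro k hk
          have := h k (by simp; omega)
          simp at this
          omega
        rw [← add_assoc, hφE, ih h', if_neg, add_zero]
        rintro ⟨β, hβ, h1, h2⟩
        rw [hEdef] at hβ
        obtain ⟨σ, hσ, rfl⟩ := hβ
        simp at h2
        omega
    set cU : Fin d → ℕ := fun j => if j ∈ U then 0 else cE j with hcU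
    set cU' : Fin d → ℕ := fun j => if j ∈ U then 0 else c' j with hcU'
    have e1 : φE (ω + cU') = φE cU := by
      rw [← hlow cU (fun j => if j ∈ U then ω j else 0)]
      · congr 1
        funext j
        simp only [hcU, hcU', hc', Pi.add_apply]
        split_ifs <;> omega
      · intro i hi
        by_cases hiU : i ∈ U
        · simp [hcU, hiU]
        · simp [hiU] at hi
    have e2 := hshift cU'
    have e3 := hshift c'
    have e4 : φS cE = φS c' + Finset.univ.sum ω := by
      rw [hc', add_comm, phi_count hc'up hφS]
      intro i _; exact le_rfl
    have e5 : φS cU = φS cU' + Finset.univ.sum (fun j => if j ∈ U then 0 else ω j) := by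
      rw [← phi_count hc'up hφS]
      · congr 1
        funext j
        simp only [hcU, hcU', hc', Pi.add_apply]
        split_ifs <;> omega
      · intro i hi
        simp only [hcU']
        split_ifs at hi ⊢ <;> omega
    have e6 : U.sum ω + Finset.univ.sum (fun j => if j ∈ U then 0 else ω j)
        = Finset.univ.sum ω := by
      have : U.sum ω = Finset.univ.sum (fun j => if j ∈ U then ω j else 0) := by
        simp
      rw [this, ← Finset.sum_add_distrib]
      apply Finset.sum_congr rfl
      intro j _
      split_ifs <;> simp
    show (ψ cE - ψ cU).toNat = _
    simp only [hψ]
    rw [← hc'] at e3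
    omega

/-- Minimum of `X` above `γ`. -/
lemma exists_min {X : Set (Fin d → ℕ)} (h1 : ∀ α ∈ X, ∀ β ∈ X, α ⊓ β ∈ X)
    {c : Fin d → ℕ} (hc : ∀ x, c ≤ x → x ∈ X) (γ : Fin d → ℕ) :
    ∃ a ∈ X, γ ≤ a ∧ ∀ β ∈ X, γ ≤ β → a ≤ β := by
  have hex : ∃ n : ℕ, ∃ a ∈ X, γ ≤ a ∧ Finset.univ.sum a = n :=
    ⟨_, γ ⊔ c, hc _ le_sup_right, le_sup_left, rfl⟩
  obtain ⟨a, ha, hle, hs⟩ := Nat.find_spec hex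
  refine ⟨a, ha, hle, ?_⟩
  intro β hβ hγβ
  have h2 := Nat.find_min' hex ⟨a ⊓ β, h1 a ha β hβ, le_inf hle hγβ, rfl⟩
  rw [← hs] at h2
  by_contra hcon
  rw [Pi.le_def] at hcon
  push Not at hcon
  obtain ⟨j, hj⟩ := hcon
  have : Finset.univ.sum (a ⊓ β) < Finset.univ.sum a := by
    apply Finset.sum_lt_sum
    · intro i _; simp
    · exact ⟨j, Finset.mem_univ j, by simp; omega⟩
  omega

section Levels

variable {S E : Set (Fin d → ℕ)} {cE : Fin d → ℕ} {f : (Fin d → ℕ) → ℕ}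

lemma f_anti (hf : ∀ γ i, f γ = f (γ + ev i) + if Drop S E γ i then 1 else 0)
    {γ δ : Fin d → ℕ} (h : γ ≤ δ) : f δ ≤ f γ := by
  obtain ⟨η, rfl⟩ := exists_add_of_le h
  clear h
  revert η
  apply vec_ind
  · simp
  · intro η i ih
    have := hf (γ + η) i
    rw [← add_assoc]
    omega

lemma f_const (hf : ∀ γ i, f γ = f (γ + ev i) + if Drop S E γ i then 1 else 0)
    {γ a : Fin d → ℕ} (h : γ ≤ a) (hmin : ∀ β ∈ S, γ ≤ β → a ≤ β) : f a = f γ := by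
  obtain ⟨η, rfl⟩ := exists_add_of_le h
  clear h
  revert η
  apply vec_ind (P := fun η => (∀ β ∈ S, γ ≤ β → γ + η ≤ β) → f (γ + η) = f γ)
  · intro _; simp
  · intro η i ih h
    have h' : ∀ β ∈ S, γ ≤ β → γ + η ≤ β := by
      intro β hβ hle
      have := h β hβ hle
      rw [← add_assoc] at this
      exact (le_add_ev _ i).trans this
    have h1 := hf (γ + η) i
    rw [if_neg, add_zero] at h1
    · rw [← add_assoc, ← h1, ih h']
    · rintro ⟨⟨β, hβ, h2, h3⟩, _⟩
      have h4 := h β hβ (le_trans (by intro j; simp) h2)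
      rw [← add_assoc] at h4
      have := lt_of_add_ev_le h4
      omega

lemma f_walk (hf : ∀ γ i, f γ = f (γ + ev i) + if Drop S E γ i then 1 else 0)
    {γ δ : Fin d → ℕ} (h : γ ≤ δ) {v : ℕ} (h1 : v ≤ f γ) (h2 : f δ < v) :
    ∃ γ' i, γ ≤ γ' ∧ γ' ≤ δ ∧ γ' i < δ i ∧ f γ' = v ∧ Drop S E γ' i := by
  obtain ⟨η, rfl⟩ := exists_add_of_le h
  clear h
  revert η
  apply vec_ind (d := d) (P := fun η : Fin d → ℕ => f (γ + η) < v → ∃ γ' : Fin d → ℕ, ∃ i : Fin d, γ ≤ γ' ∧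
    γ' ≤ γ + η ∧ γ' i < (γ + η) i ∧ f γ' = v ∧ Drop S E γ' i)
  · intro h; simp at h; omega
  · intro η i ih h
    by_cases hc : f (γ + η) < v
    · obtain ⟨γ', k, a1, a2, a3, a4, a5⟩ := ih hc
      refine ⟨γ', k, a1, ?_, ?_, a4, a5⟩
      · rw [← add_assoc]; exact a2.trans (le_add_ev _ _)
      · rw [← add_assoc]; exact lt_of_lt_of_le a3 (le_add_ev _ _ _)
    · have h3 := hf (γ + η) i
      rw [← add_assoc] at h ⊢
      by_cases hd : Drop S E (γ + η) i
      · rw [if_pos hd] at h3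
        refine ⟨γ + η, i, by intro j; simp, le_add_ev _ _, by simp [ev_self], by omega, hd⟩
      · rw [if_neg hd] at h3
        omega

lemma f_drop (hf : ∀ γ i, f γ = f (γ + ev i) + if Drop S E γ i then 1 else 0)
    (hG1 : ∀ α ∈ S, ∀ β ∈ S, α ⊓ β ∈ S) (hcS : ∀ x, cE ≤ x → x ∈ S)
    {γ : Fin d → ℕ} {i : Fin d} (h : Drop S E γ i) :
    ∃ a ∈ S \ E, γ ≤ a ∧ a i = γ i ∧ f a = f γ ∧ ∀ β ∈ S, γ ≤ β → a ≤ β := by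
  obtain ⟨a, ha, hle, hmin⟩ := exists_min hG1 hcS γ
  obtain ⟨⟨β, hβ, h1, h2⟩, h3⟩ := h
  have hai : a i = γ i := by
    have a1 := ple (hmin β hβ h1) i
    have a2 := ple hle i
    omega
  exact ⟨a, ⟨ha, fun hE => h3 ⟨a, hE, hle, hai⟩⟩, hle, hai, f_const hf hle hmin, hmin⟩

lemma exists_drop (hG1E : ∀ α ∈ E, ∀ β ∈ E, α ⊓ β ∈ E) (hcE : ∀ x, cE ≤ x → x ∈ E)
    {α : Fin d → ℕ} (hα : α ∈ S \ E) : ∃ i, Drop S E α i := by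
  by_contra hcon
  push Not at hcon
  have hall : ∀ i, Chi E α i := by
    intro i
    by_contra h
    exact hcon i ⟨⟨α, hα.1, le_rfl, rfl⟩, h⟩
  obtain ⟨a, ha, hle, hmin⟩ := exists_min hG1E hcE α
  have : a = α := by
    funext i
    obtain ⟨β, hβ, h1, h2⟩ := hall i
    have a1 := ple (hmin β hβ h1) i
    have a2 := ple hle i
    omega
  exact hα.2 (this ▸ ha)

/-- `b i` is the minimum of `S` above `α + e_i`. -/
def MinFam (S : Set (Fin d → ℕ)) (α : Fin d → ℕ) (b : Fin d → Fin d → ℕ) : Prop :=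
  ∀ i, b i ∈ S ∧ α + ev i ≤ b i ∧ ∀ β ∈ S, α + ev i ≤ β → b i ≤ β

lemma minfam_disj (hG2 : GTwo S) {α : Fin d → ℕ} (hα : α ∈ S) {b : Fin d → Fin d → ℕ}
    (hb : MinFam S α b) {β : Fin d → ℕ} (hβ : β ∈ S) (hle : α ≤ β) {i : Fin d}
    (hi : β i = α i) {j : Fin d} (hj : α j < β j) : b i j = α j := by
  have hne : α ≠ β := by rintro rfl; omega
  obtain ⟨ε, hε, h1, h2⟩ := hG2 α hα β hβ hne i hi.symm
  have hij : j ≠ i := by rintro rfl; omega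
  have hge : α ≤ ε := by
    intro k
    by_cases hk : k = i
    · rw [hk]
      show α i ≤ ε i
      omega
    · have a1 := (h2 k hk).1
      have a2 := ple hle k
      show α k ≤ ε k
      omega
  have a1 := ple ((hb i).2.2 ε hε (add_ev_le hge h1)) j
  have a2 := (h2 j hij).2 (by omega)
  have a3 := ple ((le_add_ev α i).trans (hb i).2.1) j
  have a4 := ple hle j
  omega

lemma minfam_eq (hG2 : GTwo S) {α : Fin d → ℕ} (hα : α ∈ S) {b : Fin d → Fin d → ℕ}
    (hb : MinFam S α b) {i j : Fin d} (hj : α j < b i j) : b i = b j := by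
  have hge : ∀ i, α ≤ b i := fun i => (le_add_ev α i).trans (hb i).2.1
  have h1 : b j ≤ b i := (hb j).2.2 _ (hb i).1 (add_ev_le (hge i) hj)
  have h2 : α i < b j i := by
    by_contra hcon
    have h3 : b j i = α i := le_antisymm (not_lt.mp hcon) (hge j i)
    have h4 := minfam_disj hG2 hα hb (hb j).1 (hge j) h3 (lt_of_add_ev_le (hb j).2.1)
    omega
  exact le_antisymm ((hb i).2.2 _ (hb j).1 (add_ev_le (hge j) h2)) h1

lemma exists_complete (hG2 : GTwo S) {α : Fin d → ℕ} (hα : α ∈ S) {b : Fin d → Fin d → ℕ}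
    (hb : MinFam S α b) {a : Fin d → ℕ} (ha : a ∈ S) (hαa : α ≤ a)
    {x : Fin d} (hx : α x < a x) {y : Fin d} (hy : a y = α y)
    {B : Set (Fin d → ℕ)} (haB : a ∈ B) (hbB : ∀ i, a i = α i → b i ∈ B) :
    ∃ r : ℕ, 1 < r ∧ r ≤ d ∧ ∃ β : Fin r → Fin d → ℕ, (∀ k, β k ∈ B) ∧
      IsCompleteInf S α β := by
  have hge : ∀ i, α ≤ b i := fun i => (le_add_ev α i).trans (hb i).2.1
  have hbi : ∀ i, α i < b i i := fun i => lt_of_add_ev_le (hb i).2.1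
  -- representatives
  have hrep : ∀ i, a i = α i → ∃ k, (a k = α k ∧ ∀ j, α j < b k j → k ≤ j) ∧ b k = b i := by
    intro i hi
    obtain ⟨k, hk, hkm⟩ := Finset.exists_min_image
      (Finset.univ.filter (fun j => α j < b i j)) id ⟨i, by simp [hbi]⟩
    simp at hk hkm
    have e : b i = b k := minfam_eq hG2 hα hb hk
    refine ⟨k, ⟨?_, ?_⟩, e.symm⟩
    · by_contra hcon
      have h1 : α k < a k := lt_of_le_of_ne (hαa k) (Ne.symm hcon)
      have := minfam_disj hG2 hα hb ha hαa hi h1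
      omega
    · intro j hj
      rw [← e] at hj
      exact hkm j hj
  let R := {k : Fin d // a k = α k ∧ ∀ j, α j < b k j → k ≤ j}
  let g : Option R → Fin d → ℕ := fun o => o.elim a (fun k => b k.1)
  let e := Fintype.equivFin (Option R)
  have hmem : ∀ o, g o ∈ S := by
    rintro (_ | k)
    · exact ha
    · exact (hb _).1
  have hgge : ∀ o, α ≤ g o := by
    rintro (_ | k)
    · exact hαa
    · exact hge _
  have hdis : ∀ o o', o ≠ o' → ∀ j, α j < g o j → g o' j = α j := by
    rintro (_ | k) (_ | k') hne j hj
    · exact absurd rfl hne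
    · exact minfam_disj hG2 hα hb ha hαa k'.2.1 hj
    · by_contra hcon
      have h1 : α j < a j := lt_of_le_of_ne (hαa j) (Ne.symm hcon)
      have := minfam_disj hG2 hα hb ha hαa k.2.1 h1
      change α j < b k.1 j at hj
      omega
    · by_contra hcon
      have h1 : α j < b k'.1 j := lt_of_le_of_ne (hge _ j) (Ne.symm hcon)
      have e1 := minfam_eq hG2 hα hb h1
      have e2 : b k.1 = b j := minfam_eq hG2 hα hb hj
      have l1 : k.1 ≤ k'.1 := k.2.2 _ (by rw [e2, ← e1]; exact hbi _)
      have l2 : k'.1 ≤ k.1 := k'.2.2 _ (by rw [e1, ← e2]; exact hbi _)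
      exact hne (by rw [Subtype.ext (le_antisymm l1 l2)])
  have hcov : ∀ z, ∃ o, α z < g o z := by
    intro z
    by_cases hz : α z < a z
    · exact ⟨none, hz⟩
    · obtain ⟨k, hk, hkb⟩ := hrep z (le_antisymm (not_lt.mp hz) (hαa z))
      refine ⟨some ⟨k, hk⟩, ?_⟩
      show α z < b k z
      rw [hkb]; exact hbi z
  have hpos : ∀ o, ∃ z, α z < g o z := by
    rintro (_ | k)
    · exact ⟨x, hx⟩
    · exact ⟨k.1, hbi _⟩
  have hprop : ∀ o, ∃ z, g o z = α z := by
    rintro (_ | k)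
    · exact ⟨y, hy⟩
    · exact ⟨x, minfam_disj hG2 hα hb ha hαa k.2.1 hx⟩
  have hgB : ∀ o, g o ∈ B := by
    rintro (_ | k)
    · exact haB
    · exact hbB _ k.2.1
  have hcard : 1 < Fintype.card (Option R) := by
    obtain ⟨k, hk, _⟩ := hrep y hy
    exact Fintype.one_lt_card_iff.mpr ⟨none, some ⟨k, hk⟩, by simp⟩
  refine ⟨Fintype.card (Option R), hcard, ?_, fun k => g (e.symm k), fun k => hgB _, hcard,
    fun k => Finset.univ.filter (fun z => g (e.symm k) z = α z), ?_, ?_, ?_, ?_⟩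
  · choose z hz using hpos
    have hinj : Function.Injective z := by
      intro o o' h
      by_contra hne
      have h1 := hdis o o' hne (z o) (hz o)
      have h2 := hz o'
      rw [← h] at h2
      omega
    simpa using Fintype.card_le_of_injective z hinj
  · intro k
    constructor
    · obtain ⟨z, hz⟩ := hprop (e.symm k)
      exact ⟨z, by simp [hz]⟩
    · intro h
      obtain ⟨z, hz⟩ := hpos (e.symm k)
      have : z ∈ Finset.univ.filter (fun z => g (e.symm k) z = α z) := by
        change Finset.univ.filter (fun z => g (e.symm k) z = α z) = _ at h
        rw [h]; simp
      simp at this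
      omega
  · intro k
    refine ⟨hmem _, ?_, ?_⟩
    · intro i hi
      simpa using hi
    · intro j hj
      simp at hj
      exact lt_of_le_of_ne (hgge _ j) (Ne.symm hj)
  · intro j k hjk
    funext z
    have hne : e.symm j ≠ e.symm k := fun h => hjk (e.symm.injective h)
    have h1 := hdis _ _ hne z
    have h2 := ple (hgge (e.symm j)) z
    have h3 := ple (hgge (e.symm k)) z
    simp only [Pi.inf_apply]
    by_cases hc : α z < g (e.symm j) z
    · have := h1 hc; omega
    · omega
  · intro z
    obtain ⟨o, ho⟩ := hcov z
    refine ⟨e o, ?_⟩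
    simp
    omega

lemma Dstep_eq (hd : 1 ≤ d)
    (hf : ∀ γ i, f γ = f (γ + ev i) + if Drop S E γ i then 1 else 0)
    (hG1 : ∀ α ∈ S, ∀ β ∈ S, α ⊓ β ∈ S) (hG2 : GTwo S) (hcS : ∀ x, cE ≤ x → x ∈ S)
    (hG1E : ∀ α ∈ E, ∀ β ∈ E, α ⊓ β ∈ E) (hcE : ∀ x, cE ≤ x → x ∈ E)
    (htop : ∀ γ, cE ≤ γ → f γ = 0)
    (j : ℕ) (prev : Set (Fin d → ℕ)) (hprev : prev = {α | α ∈ S \ E ∧ f α ≤ j}) :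
    Dstep S E prev = {α | α ∈ S \ E ∧ f α = j + 1} := by
  have hrem : ∀ α, α ∈ (S \ E) \ prev ↔ α ∈ S \ E ∧ j + 1 ≤ f α := by
    intro α
    subst hprev
    constructor
    · rintro ⟨h1, h2⟩
      refine ⟨h1, ?_⟩
      by_contra h
      exact h2 ⟨h1, by omega⟩
    · rintro ⟨h1, h2⟩
      refine ⟨h1, fun h3 => ?_⟩
      have := h3.2
      omega
  let z0 : Fin d := ⟨0, hd⟩
  ext α
  constructor
  · rintro ⟨hB, hC⟩
    have hαR := (hrem α).mp hB.1
    refine ⟨hαR.1, ?_⟩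
    by_contra hne
    have hfα : j + 2 ≤ f α := by have := hαR.2; omega
    have hαS := hαR.1.1
    apply hC
    refine ⟨hB, ?_⟩
    -- nothing strictly above
    have habove : ∀ β, β ∈ S \ E → j + 1 ≤ f β → (∀ k, α k < β k) → False := by
      intro β h1 h2 h3
      have := hB.2 β ((hrem β).mpr ⟨h1, h2⟩) (Or.inr h3)
      have h4 := h3 z0
      rw [this] at h4
      omega
    have hBmem : ∀ β, β ∈ S \ E → α ≤ β → j + 1 ≤ f β → β ∈ Bstep S E prev := by
      intro β h1 h2 h3
      refine ⟨(hrem β).mpr ⟨h1, h3⟩, ?_⟩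
      rintro β' hβ' (h4 | h4)
      · exact h4.symm
      · exact (habove β' hβ'.1 ((hrem β').mp hβ').2
          (fun k => lt_of_le_of_lt (h2 k) (h4 k))).elim
    have hone : f (α + 1) ≤ j := by
      by_contra hcon
      have h1 : f ((α + 1) ⊔ cE) < f (α + 1) := by
        rw [htop _ le_sup_right]; omega
      obtain ⟨γ, i, a1, a2, a3, a4, a5⟩ :=
        f_walk hf (le_sup_left : α + 1 ≤ (α + 1) ⊔ cE) le_rfl h1
      obtain ⟨a, haA, h2, h3, h4, h5⟩ := f_drop hf hG1 hcS a5
      apply habove a haA (by omega)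
      intro k
      have b1 := ple a1 k
      have b2 := ple h2 k
      simp at b1
      omega
    have hbex : ∀ i, ∃ b, b ∈ S ∧ α + ev i ≤ b ∧ ∀ β ∈ S, α + ev i ≤ β → b ≤ β := by
      intro i
      obtain ⟨b, h1, h2, h3⟩ := exists_min hG1 hcS (α + ev i)
      exact ⟨b, h1, h2, h3⟩
    choose b hb using hbex
    have hbM : MinFam S α b := hb
    have hge : ∀ i, α ≤ b i := fun i => (le_add_ev α i).trans (hb i).2.1
    have hfb : ∀ i, j + 1 ≤ f (b i) := by
      intro i
      have h1 := f_const hf (hb i).2.1 (hb i).2.2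
      have h2 := hf α i
      split_ifs at h2 <;> omega
    -- the seed
    have hseed : ∃ a ∈ S \ E, α ≤ a ∧ j + 1 ≤ f a ∧ (∃ x, α x < a x) ∧ (∃ y, a y = α y) ∧
        ∀ i, a i = α i → b i ∈ S \ E := by
      by_cases hall : ∀ i, b i ∉ E
      · refine ⟨b z0, ⟨(hb z0).1, hall z0⟩, hge z0, hfb z0,
          ⟨z0, lt_of_add_ev_le (hb z0).2.1⟩, ?_, fun i _ => ⟨(hb i).1, hall i⟩⟩
        by_contra hcon
        push Not at hcon
        have h1 : α + 1 ≤ b z0 := by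
          intro k
          have h2 := hcon k
          have h3 := ple (hge z0) k
          show α k + 1 ≤ b z0 k
          omega
        have h2 := f_anti hf h1
        have h3 := hfb z0
        omega
      · push Not at hall
        obtain ⟨q, hq⟩ := hall
        have h1 : f (b q ⊔ (α + 1)) < j + 1 := by
          have := f_anti hf (le_sup_right : α + 1 ≤ b q ⊔ (α + 1))
          omega
        obtain ⟨γ, i, a1, a2, a3, a4, a5⟩ :=
          f_walk hf (le_sup_left : b q ≤ b q ⊔ (α + 1)) (hfb q) h1
        obtain ⟨a, haA, h2, h3, h4, h5⟩ := f_drop hf hG1 hcS a5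
        have hai : a i = α i := by
          have b1 := ple a1 i
          have b2 := ple (hge q) i
          simp at a3
          omega
        have hαa : α ≤ a := (hge q).trans (a1.trans h2)
        refine ⟨a, haA, hαa, by omega, ⟨q, ?_⟩, ⟨i, hai⟩, ?_⟩
        · exact lt_of_lt_of_le (lt_of_add_ev_le (hb q).2.1) (a1.trans h2 q)
        · intro k hk
          refine ⟨(hb k).1, fun hkE => ?_⟩
          obtain ⟨i0, hi0⟩ := exists_drop hG1E hcE hαR.1
          have c1 : α i0 < b q i0 := by
            refine lt_of_le_of_ne (hge q i0) (fun h => hi0.2 ⟨b q, hq, hge q, h.symm⟩)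
          have c2 : α i0 < b k i0 := by
            refine lt_of_le_of_ne (hge k i0) (fun h => hi0.2 ⟨b k, hkE, hge k, h.symm⟩)
          have c3 : α i0 < a i0 := lt_of_lt_of_le c1 (a1.trans h2 i0)
          have := minfam_disj hG2 hαS hbM haA.1 hαa hk c3
          omega
    obtain ⟨a, haA, hαa, hfa, ⟨x, hx⟩, ⟨y, hy⟩, hbA⟩ := hseed
    obtain ⟨r, hr1, hr2, β, hβ, hinf⟩ := exists_complete hG2 hαS hbM haA.1 hαa hx hy
      (B := Bstep S E prev) (hBmem a haA hαa hfa)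
      (fun i hi => hBmem _ (hbA i hi) (hge i) (hfb i))
    exact ⟨r, hr1, hr2, β, hβ, hαR.1, fun k => (hβ k).1.1, hinf⟩
  · rintro ⟨hα, hfα⟩
    obtain ⟨i, hi⟩ := exists_drop hG1E hcE hα
    have h1 := hf α i
    rw [if_pos hi] at h1
    have key : ∀ β, α ≤ β → α i < β i → f β ≤ j := by
      intro β h2 h3
      have := f_anti hf (add_ev_le h2 h3)
      omega
    refine ⟨⟨(hrem α).mpr ⟨hα, by omega⟩, ?_⟩, ?_⟩
    · rintro β hβ (h2 | h2)
      · exact h2.symm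
      · have h3 := key β (fun k => (h2 k).le) (h2 i)
        have h4 := ((hrem β).mp hβ).2
        omega
    · rintro ⟨_, r, _, _, β, hβ, _, _, _, F, _, hF2, _, hF4⟩
      obtain ⟨k, hk⟩ := hF4 i
      obtain ⟨_, g1, g2⟩ := hF2 k
      have hle : α ≤ β k := by
        intro l
        by_cases hl : l ∈ F k
        · exact (g1 l hl).ge
        · exact (g2 l hl).le
      have h3 := key (β k) hle (g2 i hk)
      have h4 := ((hrem _).mp (hβ k).1).2
      omega

end Levels

lemma sum_le_first (ω : Fin d → ℕ) (hdec : ∀ i j : Fin d, i ≤ j → ω j ≤ ω i)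
    (U : Finset (Fin d)) :
    U.sum ω ≤ (Finset.univ.filter (fun j : Fin d => (j : ℕ) < U.card)).sum ω := by
  set W := Finset.univ.filter (fun j : Fin d => (j : ℕ) < U.card) with hW
  have hUd : U.card ≤ d := by simpa using Finset.card_le_univ U
  have hWc : W.card = U.card := by
    rw [hW, Fin.card_filter_val_lt]
    omega
  rw [← Finset.sum_sdiff (Finset.inter_subset_left : U ∩ W ⊆ U),
    ← Finset.sum_sdiff (Finset.inter_subset_right : U ∩ W ⊆ W)]
  apply Nat.add_le_add_right
  have c1 := Finset.card_sdiff_add_card_eq_card (Finset.inter_subset_left : U ∩ W ⊆ U)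
  have c2 := Finset.card_sdiff_add_card_eq_card (Finset.inter_subset_right : U ∩ W ⊆ W)
  have hc : (U \ (U ∩ W)).card = (W \ (U ∩ W)).card := by omega
  by_cases hlt : U.card < d
  · calc (U \ (U ∩ W)).sum ω ≤ (U \ (U ∩ W)).card • ω ⟨U.card, hlt⟩ := by
          apply Finset.sum_le_card_nsmul
          intro x hx
          simp [hW] at hx
          apply hdec
          rw [Fin.le_def]
          exact hx.2
      _ = (W \ (U ∩ W)).card • ω ⟨U.card, hlt⟩ := by rw [hc]
      _ ≤ _ := by
          apply Finset.card_nsmul_le_sum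
          intro x hx
          simp [hW] at hx
          apply hdec
          rw [Fin.le_def]
          exact hx.1.le
  · have : U \ (U ∩ W) = ∅ := by
      ext x
      have := x.2
      simp [hW]
      intro _
      omega
    rw [this]; simp

end Helpers

theorem stmt_19 {d : ℕ} (hd : 1 ≤ d) (S : Set (Fin d → ℕ))
    (hS : IsGoodSemigroup S)
    (ω : Fin d → ℕ) (hω : ω ∈ S) (hω0 : ω ≠ 0)
    (hdec : ∀ i j : Fin d, i ≤ j → ω j ≤ ω i)
    (E : Set (Fin d → ℕ)) (hEdef : E = {x | ∃ σ ∈ S, x = ω + σ})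
    (cE : Fin d → ℕ) (hcE : IsConductor E cE)
    (N : ℕ) (hN : IsLevelsNumber S E N) :
    (∀ k : ℕ, 1 ≤ k → k ≤ d → ∀ i : ℕ, 1 ≤ i → i ≤ N →
      ((∃ U : Finset (Fin d), U.card = k ∧
          ∃ α : Fin d → ℕ, (∀ j ∉ U, α j = cE j) ∧ α ∈ Alevel S E N i) ↔
        N + 1 ≤ i + (Finset.univ.filter (fun j : Fin d => (j : ℕ) < k)).sum ω)) ∧
    N = Finset.univ.sum ω := by
  classical
  obtain ⟨hS0, hadd, hG1, hG2, _⟩ := hS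
  have hG2' : GTwo S := hG2
  have hES : E ⊆ S := by
    rw [hEdef]
    rintro _ ⟨σ, hσ, rfl⟩
    exact hadd _ hω _ hσ
  have hG1E : ∀ α ∈ E, ∀ β ∈ E, α ⊓ β ∈ E := by
    rw [hEdef]
    rintro _ ⟨α, hα, rfl⟩ _ ⟨β, hβ, rfl⟩
    refine ⟨α ⊓ β, hG1 _ hα _ hβ, ?_⟩
    funext k
    simp
  have hcE' := hcE.1
  have hcS : ∀ x, cE ≤ x → x ∈ S := fun x hx => hES (hcE' x hx)
  obtain ⟨f, hf, htop, hval⟩ := exists_f hG2' hES hEdef hcE'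
  have hDacc : ∀ j, Dacc S E j = {α | α ∈ S \ E ∧ f α ≤ j} := by
    intro j
    induction j with
    | zero =>
      ext α
      simp only [Dacc, Set.mem_empty_iff_false, false_iff]
      rintro ⟨h1, h2⟩
      obtain ⟨i, hi⟩ := exists_drop hG1E hcE' h1
      have := hf α i
      rw [if_pos hi] at this
      omega
    | succ j ih =>
      rw [Dacc, Dstep_eq hd hf hG1 hG2' hcS hG1E hcE' htop j _ ih, ih]
      ext α
      simp only [Set.mem_union, Set.mem_ofPred_eq]
      constructor
      · rintro (⟨h1, h2⟩ | ⟨h1, h2⟩)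
        · exact ⟨h1, by omega⟩
        · exact ⟨h1, by omega⟩
      · rintro ⟨h1, h2⟩
        rcases Nat.lt_or_ge j (f α) with h3 | h3
        · exact Or.inr ⟨h1, by omega⟩
        · exact Or.inl ⟨h1, h3⟩
  have hD : ∀ j, Dstep S E (Dacc S E j) = {α | α ∈ S \ E ∧ f α = j + 1} := fun j =>
    Dstep_eq hd hf hG1 hG2' hcS hG1E hcE' htop j _ (hDacc j)
  have hf0 : f 0 = Finset.univ.sum ω := by
    rw [← hval Finset.univ]
    congr 1
    funext j
    simp
  have h0A : (0 : Fin d → ℕ) ∈ S \ E := by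
    refine ⟨hS0, ?_⟩
    rw [hEdef]
    rintro ⟨σ, _, h⟩
    apply hω0
    funext k
    have := congrFun h k
    simp at this
    simp
    omega
  have hNf : N = f 0 := by
    apply le_antisymm
    · apply hN.2
      intro α hα
      rw [hDacc]
      exact ⟨hα, f_anti hf (by intro k; simp)⟩
    · have := hN.1 h0A
      rw [hDacc] at this
      exact this.2
  refine ⟨?_, by rw [hNf, hf0]⟩
  intro k hk1 hkd i hi1 hiN
  have hA : Alevel S E N i = {α | α ∈ S \ E ∧ f α = N - i + 1} := by
    rw [Alevel, if_pos ⟨hi1, hiN⟩, hD]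
  rw [hA]
  constructor
  · rintro ⟨U, hU, α, hα, hαA, hfα⟩
    have h1 : f α ≤ U.sum ω := by
      rw [← hval U]
      apply f_anti hf
      intro j
      by_cases hj : j ∈ U
      · simp [hj]
      · simp [hj, hα j hj]
    have h2 := sum_le_first ω hdec U
    rw [hU] at h2
    omega
  · intro h
    set U := Finset.univ.filter (fun j : Fin d => (j : ℕ) < k) with hUdef
    have hUc : U.card = k := by
      rw [hUdef, Fin.card_filter_val_lt]
      omega
    refine ⟨U, hUc, ?_⟩
    have hle : (fun j => if j ∈ U then 0 else cE j) ≤ cE := by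
      intro j
      by_cases hj : j ∈ U <;> simp [hj]
    obtain ⟨γ, l, a1, a2, a3, a4, a5⟩ := f_walk hf hle (v := N - i + 1)
      (by rw [hval U]; omega) (by rw [htop cE le_rfl]; omega)
    obtain ⟨a, haA, h2, h3, h4, h5⟩ := f_drop hf hG1 hcS a5
    refine ⟨a, ?_, haA, by omega⟩
    intro j hj
    have h6 := ple (h5 cE (hcS cE le_rfl) a2) j
    have h7 := ple a1 j
    have h8 := ple h2 j
    simp only [hj, if_false] at h7
    omega
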